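/- Let H be a real, separable, infinite-dimensional Hilbert space. The set of bounded operators T : H → H that are self-adjoint, invertible, and strongly indefinite is path-connected in the operator-norm topology. -/

import Mathlib

open scoped RealInnerProductSpace

section StronglyIndefinite

variable {H L : Type*} [NormedAddCommGroup H] [InnerProductSpace ℝ H]
  [NormedAddCommGroup L] [InnerProductSpace ℝ L]

/-- The set of self-adjoint, invertible, strongly indefinite operators on `H`. -/
def stronglyIndefiniteOperators (H : Type*) [NormedAddCommGroup H] [InnerProductSpace ℝ H]
    [CompleteSpace H] : Set (H →L[ℝ] H) :=
  {T : H →L[ℝ] H |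
      IsSelfAdjoint T ∧ IsUnit T ∧
      ∃ Ep Em : Submodule ℝ H,
        IsClosed (Ep : Set H) ∧ IsClosed (Em : Set H) ∧
        ¬ FiniteDimensional ℝ Ep ∧ ¬ FiniteDimensional ℝ Em ∧
        Ep ⊔ Em = ⊤ ∧
        (∀ x ∈ Ep, ∀ y ∈ Em, ⟪x, y⟫ = 0) ∧
        (∀ x ∈ Ep, T x ∈ Ep) ∧ (∀ x ∈ Em, T x ∈ Em) ∧
        (∀ x ∈ Ep, x ≠ 0 → 0 < ⟪T x, x⟫) ∧
        (∀ x ∈ Em, x ≠ 0 → ⟪T x, x⟫ < 0)}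

/-- An infinite-dimensional subspace contains a nonzero vector orthogonal to any given finite
set. -/
lemma exists_ne_zero_mem_forall_inner_eq_zero {E : Submodule ℝ H}
    (hE : ¬ FiniteDimensional ℝ E) (s : Finset H) :
    ∃ x ∈ E, x ≠ 0 ∧ ∀ y ∈ s, ⟪y, x⟫ = 0 := by
  by_contra! h
  let f : E →ₗ[ℝ] (s → ℝ) := LinearMap.pi fun y => (innerₛₗ ℝ (y : H)) ∘ₗ E.subtype
  have hf : Function.Injective f := by
    refine (injective_iff_map_eq_zero f).2 fun x hx => ?_
    by_contra hx0
    obtain ⟨y, hy, hyx⟩ := h x x.2 (by simpa using hx0)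
    exact hyx (congrFun hx ⟨y, hy⟩)
  exact hE (FiniteDimensional.of_injective f hf)

/-- A subspace containing a sequence of nonzero pairwise orthogonal vectors is
infinite-dimensional. -/
lemma not_finiteDimensional_of_pairwise_inner_eq_zero {E : Submodule ℝ H} {a : ℕ → H}
    (ha : ∀ n, a n ∈ E) (h0 : ∀ n, a n ≠ 0) (hort : Pairwise fun m n => ⟪a m, a n⟫ = 0) :
    ¬ FiniteDimensional ℝ E := by
  intro hfin
  have hli : LinearIndependent ℝ (fun n => (⟨a n, ha n⟩ : E)) :=
    linearIndependent_of_ne_zero_of_inner_eq_zero (fun n h => h0 n (congrArg Subtype.val h))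
      (fun m n hmn => hort hmn)
  have := hli.finite
  exact not_finite ℕ

/-- Two infinite-dimensional closed subspaces contain infinite-dimensional closed subspaces that
are orthogonal to each other. -/
lemma exists_isOrtho_le_of_not_finiteDimensional {E F : Submodule ℝ H}
    (hEc : IsClosed (E : Set H)) (hFc : IsClosed (F : Set H))
    (hE : ¬ FiniteDimensional ℝ E) (hF : ¬ FiniteDimensional ℝ F) :
    ∃ A B : Submodule ℝ H, A ≤ E ∧ B ≤ F ∧ IsClosed (A : Set H) ∧ IsClosed (B : Set H) ∧
      ¬ FiniteDimensional ℝ A ∧ ¬ FiniteDimensional ℝ B ∧ A ⟂ B := by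
  classical
  let P : H × H → Prop := fun p => p.1 ∈ E ∧ p.1 ≠ 0 ∧ p.2 ∈ F ∧ p.2 ≠ 0 ∧ ⟪p.1, p.2⟫ = 0
  let r : H × H → H × H → Prop := fun p q =>
    ⟪p.1, q.1⟫ = 0 ∧ ⟪p.1, q.2⟫ = 0 ∧ ⟪p.2, q.1⟫ = 0 ∧ ⟪p.2, q.2⟫ = 0
  have : Std.Symm r := ⟨fun p q ⟨h1, h2, h3, h4⟩ =>
    ⟨inner_eq_zero_symm.1 h1, inner_eq_zero_symm.1 h3, inner_eq_zero_symm.1 h2,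
      inner_eq_zero_symm.1 h4⟩⟩
  obtain ⟨f, hfP, hfr⟩ := exists_seq_of_forall_finset_exists' P r (by
    intro s _
    obtain ⟨a, haE, ha0, ha⟩ :=
      exists_ne_zero_mem_forall_inner_eq_zero hE (s.image Prod.fst ∪ s.image Prod.snd)
    obtain ⟨b, hbF, hb0, hb⟩ := exists_ne_zero_mem_forall_inner_eq_zero hF
      (insert a (s.image Prod.fst ∪ s.image Prod.snd))
    refine ⟨(a, b), ⟨haE, ha0, hbF, hb0, hb a (Finset.mem_insert_self _ _)⟩, fun x hx => ?_⟩
    have h1 : x.1 ∈ s.image Prod.fst ∪ s.image Prod.snd :=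
      Finset.mem_union_left _ (Finset.mem_image_of_mem _ hx)
    have h2 : x.2 ∈ s.image Prod.fst ∪ s.image Prod.snd :=
      Finset.mem_union_right _ (Finset.mem_image_of_mem _ hx)
    exact ⟨ha _ h1, hb _ (Finset.mem_insert_of_mem h1), ha _ h2,
      hb _ (Finset.mem_insert_of_mem h2)⟩)
  have hab : ∀ m n, ⟪(f m).1, (f n).2⟫ = 0 := fun m n => by
    rcases eq_or_ne m n with rfl | hmn
    · exact (hfP m).2.2.2.2
    · exact (hfr hmn).2.1
  let S : Submodule ℝ H := Submodule.span ℝ (Set.range fun n => (f n).2)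
  have haA : ∀ n, (f n).1 ∈ E ⊓ Sᗮ := fun n => by
    refine ⟨(hfP n).1, (Submodule.mem_orthogonal' _ _).2 fun u hu => ?_⟩
    induction hu using Submodule.span_induction with
    | mem x hx => obtain ⟨m, rfl⟩ := hx; exact hab n m
    | zero => simp
    | add x y _ _ hx hy => rw [inner_add_right, hx, hy, add_zero]
    | smul c x _ hx => rw [inner_smul_right, hx, mul_zero]
  have hbB : ∀ n, (f n).2 ∈ F ⊓ (E ⊓ Sᗮ)ᗮ := fun n =>
    ⟨(hfP n).2.2.1, fun u hu => (Submodule.mem_orthogonal' _ _).1 hu.2 _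
      (Submodule.subset_span ⟨n, rfl⟩)⟩
  refine ⟨E ⊓ Sᗮ, F ⊓ (E ⊓ Sᗮ)ᗮ, inf_le_left, inf_le_left,
    hEc.inter (Submodule.isClosed_orthogonal _), hFc.inter (Submodule.isClosed_orthogonal _),
    not_finiteDimensional_of_pairwise_inner_eq_zero haA (fun n => (hfP n).2.1)
      (fun m n hmn => (hfr hmn).1),
    not_finiteDimensional_of_pairwise_inner_eq_zero hbB (fun n => (hfP n).2.2.2.1)
      (fun m n hmn => (hfr hmn).2.2.2), ?_⟩
  exact (Submodule.isOrtho_orthogonal_right _).mono_right inf_le_right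

/-- In a separable inner product space, an orthonormal set is countable. -/
lemma Orthonormal.countable_of_separableSpace [TopologicalSpace.SeparableSpace H] {s : Set H}
    (hs : Orthonormal ℝ ((↑) : s → H)) : Countable s := by
  have := UniformSpace.secondCountable_of_separable H
  have : DiscreteTopology s := by
    refine DiscreteTopology.of_forall_le_dist (r := 1) one_pos fun x y hxy => ?_
    change 1 ≤ dist x y
    have h := norm_sub_sq_real (x : H) (y : H)
    rw [hs.2 hxy, hs.1 x, hs.1 y] at h
    rw [Subtype.dist_eq, dist_eq_norm]
    nlinarith [norm_nonneg ((x : H) - y)]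
  exact TopologicalSpace.separableSpace_iff_countable.1 inferInstance

/-- A separable infinite-dimensional real Hilbert space is isometric to `ℓ²(ℕ, ℝ)`. -/
lemma nonempty_linearIsometryEquiv_l2 [CompleteSpace H] [TopologicalSpace.SeparableSpace H]
    (hinf : ¬ FiniteDimensional ℝ H) : Nonempty (H ≃ₗᵢ[ℝ] lp (fun _ : ℕ => ℝ) 2) := by
  obtain ⟨w, b, hb⟩ := exists_hilbertBasis ℝ H
  have hw : Orthonormal ℝ ((↑) : w → H) := hb ▸ b.orthonormal
  have : Countable w := hw.countable_of_separableSpace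
  have : Infinite w := by
    refine not_finite_iff_infinite.1 fun hfin => hinf ?_
    have := Fintype.ofFinite w
    exact b.toOrthonormalBasis.toBasis.finiteDimensional_of_finite
  obtain ⟨e⟩ := nonempty_equiv_of_countable (α := ℕ) (β := w)
  refine ⟨(HilbertBasis.mk (hw.comp e e.injective) ?_).repr⟩
  rw [Set.range_comp, e.surjective.range_eq, Set.image_univ, ← hb, b.dense_span]

variable [CompleteSpace H] [CompleteSpace L]

/-- A closed infinite-dimensional subspace of a separable Hilbert space is the range of an
isometry defined on `ℓ²(ℕ, ℝ)`. -/
lemma exists_isometry_range_eq [TopologicalSpace.SeparableSpace H] {E : Submodule ℝ H}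
    (hEc : IsClosed (E : Set H)) (hE : ¬ FiniteDimensional ℝ E) :
    ∃ G : lp (fun _ : ℕ => ℝ) 2 →L[ℝ] H, G.adjoint ∘L G = 1 ∧ G.range = E := by
  have : CompleteSpace E := hEc.completeSpace_coe
  have := UniformSpace.secondCountable_of_separable H
  obtain ⟨e⟩ := nonempty_linearIsometryEquiv_l2 hE
  refine ⟨(E.subtypeₗᵢ.comp e.symm.toLinearIsometry).toContinuousLinearMap, ?_, ?_⟩
  · exact (ContinuousLinearMap.norm_map_iff_adjoint_comp_self _).1 fun x =>
      LinearIsometry.norm_map _ x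
  · ext x
    constructor
    · rintro ⟨y, rfl⟩
      exact (e.symm y).2
    · intro hx
      exact ⟨e ⟨x, hx⟩, by simp⟩

/-- If the ranges of `G` and `K` are orthogonal then `G.adjoint ∘L K = 0`. -/
lemma adjoint_comp_eq_zero_of_isOrtho_range {G K : L →L[ℝ] H} (h : G.range ⟂ K.range) :
    G.adjoint ∘L K = 0 := by
  ext x
  refine ext_inner_left ℝ fun y => ?_
  rw [ContinuousLinearMap.comp_apply, ContinuousLinearMap.adjoint_inner_right]
  simpa using Submodule.isOrtho_iff_inner_eq.1 h (G y) ⟨y, rfl⟩ (K x) ⟨x, rfl⟩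

/-- The symmetry `2 G G* - 1`; for an isometry `G` it is the reflection in the range of `G`. -/
noncomputable def rangeReflection (G : L →L[ℝ] H) : H →L[ℝ] H := (2 : ℝ) • (G ∘L G.adjoint) - 1

lemma rangeReflection_apply (G : L →L[ℝ] H) (x : H) :
    rangeReflection G x = (2 : ℝ) • G (G.adjoint x) - x := rfl

lemma isSelfAdjoint_rangeReflection (G : L →L[ℝ] H) : IsSelfAdjoint (rangeReflection G) := by
  rw [ContinuousLinearMap.isSelfAdjoint_iff', rangeReflection]
  simp [map_sub, ContinuousLinearMap.adjoint_comp, ContinuousLinearMap.one_def,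
    ContinuousLinearMap.adjoint_id]

lemma rangeReflection_mul_self {G : L →L[ℝ] H} (hG : G.adjoint ∘L G = 1) :
    rangeReflection G * rangeReflection G = 1 := by
  have h : ∀ y, G.adjoint (G y) = y := fun y => DFunLike.congr_fun hG y
  ext x
  simp only [mul_apply_eq_comp, rangeReflection_apply, map_sub, map_smul, h,
    one_apply_eq_self]
  module

lemma isUnit_rangeReflection {G : L →L[ℝ] H} (hG : G.adjoint ∘L G = 1) :
    IsUnit (rangeReflection G) :=
  ⟨⟨_, _, rangeReflection_mul_self hG, rangeReflection_mul_self hG⟩, rfl⟩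

/-- The reflection in the range of an isometry `G` is strongly indefinite as soon as there is a
second isometry, from the same infinite-dimensional space, with range orthogonal to that of
`G`. -/
lemma rangeReflection_mem_stronglyIndefiniteOperators (hL : ¬ FiniteDimensional ℝ L)
    {G K : L →L[ℝ] H} (hG : G.adjoint ∘L G = 1) (hK : K.adjoint ∘L K = 1)
    (hGK : G.adjoint ∘L K = 0) :
    rangeReflection G ∈ stronglyIndefiniteOperators H := by
  have h : ∀ y, G.adjoint (G y) = y := fun y => DFunLike.congr_fun hG y
  have h' : ∀ y, K.adjoint (K y) = y := fun y => DFunLike.congr_fun hK y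
  have h0 : ∀ y, G.adjoint (K y) = 0 := fun y => DFunLike.congr_fun hGK y
  have hR : G.range = (1 - G ∘L G.adjoint).ker := by
    ext x
    constructor
    · rintro ⟨y, rfl⟩
      simp [h]
    · intro hx
      exact ⟨G.adjoint x, (sub_eq_zero.1 hx).symm⟩
  have hfix : ∀ x ∈ G.range, rangeReflection G x = x := by
    rintro _ ⟨y, rfl⟩
    simp only [ContinuousLinearMap.coe_coe, rangeReflection_apply, h]
    module
  have hneg : ∀ x ∈ G.adjoint.ker, rangeReflection G x = -x := fun x hx => by
    have hx' : G.adjoint x = 0 := hx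
    simp [rangeReflection_apply, hx']
  refine ⟨isSelfAdjoint_rangeReflection G, isUnit_rangeReflection hG, G.range, G.adjoint.ker,
    ?_, G.adjoint.isClosed_ker, ?_, ?_, ?_, ?_, ?_, ?_, ?_, ?_⟩
  · rw [hR]
    exact ContinuousLinearMap.isClosed_ker _
  · intro hfin
    refine hL (FiniteDimensional.of_injective (G : L →ₗ[ℝ] H).rangeRestrict ?_)
    exact fun x y hxy => Function.LeftInverse.injective h (congrArg Subtype.val hxy)
  · intro hfin
    refine hL (FiniteDimensional.of_injective
      ((K : L →ₗ[ℝ] H).codRestrict G.adjoint.ker fun y => h0 y) ?_)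
    exact fun x y hxy => Function.LeftInverse.injective h' (congrArg Subtype.val hxy)
  · refine eq_top_iff.2 fun x _ => Submodule.mem_sup.2
      ⟨G (G.adjoint x), ⟨G.adjoint x, rfl⟩, x - G (G.adjoint x), ?_, by abel⟩
    simp [h]
  · rintro _ ⟨y, rfl⟩ z hz
    have hz' : G.adjoint z = 0 := hz
    rw [ContinuousLinearMap.coe_coe, ← ContinuousLinearMap.adjoint_inner_right, hz',
      inner_zero_right]
  · intro x hx
    rwa [hfix x hx]
  · intro x hx
    rw [hneg x hx]
    exact neg_mem hx
  · intro x hx hx0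
    rw [hfix x hx]
    exact real_inner_self_pos.2 hx0
  · intro x hx hx0
    rw [hneg x hx, inner_neg_left]
    exact neg_neg_of_pos (real_inner_self_pos.2 hx0)

lemma adjoint_smul_add_smul_comp {G K G' K' : L →L[ℝ] H} (a b c d : ℝ) :
    (a • G + b • K).adjoint ∘L (c • G' + d • K') =
      (a * c) • (G.adjoint ∘L G') + (a * d) • (G.adjoint ∘L K') + (b * c) • (K.adjoint ∘L G') +
        (b * d) • (K.adjoint ∘L K') := by
  ext x
  simp only [map_add, ContinuousLinearMap.comp_apply, add_apply,
    smul_apply, map_smul]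
  module

/-- Reflections in the ranges of two isometries with orthogonal ranges are joined, by rotating
one range into the other. -/
lemma joinedIn_rangeReflection (hL : ¬ FiniteDimensional ℝ L) {G K : L →L[ℝ] H}
    (hG : G.adjoint ∘L G = 1) (hK : K.adjoint ∘L K = 1) (hGK : G.adjoint ∘L K = 0) :
    JoinedIn (stronglyIndefiniteOperators H) (rangeReflection G) (rangeReflection K) := by
  have hKG : K.adjoint ∘L G = 0 := by
    have := congrArg ContinuousLinearMap.adjoint hGK
    simpa [ContinuousLinearMap.adjoint_comp] using this
  let θ : ℝ → ℝ := fun t => t * (Real.pi / 2)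
  let F : ℝ → L →L[ℝ] H := fun t => Real.cos (θ t) • G + Real.sin (θ t) • K
  have hF : Continuous F := by fun_prop
  refine JoinedIn.ofLine (f := fun t => rangeReflection (F t)) ?_ ?_ ?_ ?_
  · refine Continuous.continuousOn ?_
    have : Continuous fun t => (F t).adjoint := ContinuousLinearMap.adjoint.continuous.comp hF
    unfold rangeReflection
    exact ((hF.clm_comp this).const_smul (2 : ℝ)).sub continuous_const
  · simp [F, θ]
  · simp [F, θ]
  · rintro _ ⟨t, -, rfl⟩
    have hcs := Real.cos_sq_add_sin_sq (θ t)
    refine rangeReflection_mem_stronglyIndefiniteOperators hL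
      (K := (-Real.sin (θ t)) • G + Real.cos (θ t) • K) ?_ ?_ ?_ <;>
    simp only [F, adjoint_smul_add_smul_comp, hG, hK, hGK, hKG, smul_zero, add_zero, ← add_smul]
    · rw [← sq, ← sq, hcs, one_smul]
    · rw [neg_mul_neg, ← sq, ← sq, add_comm, hcs, one_smul]
    · rw [show Real.cos (θ t) * -Real.sin (θ t) + Real.sin (θ t) * Real.cos (θ t) = 0 by ring,
        zero_smul]

/-- Given an operator with positive spectral subspace `Ep` and negative spectral subspace `Em`,
the segment from it to the reflection in `Ep` consists of strongly indefinite operators. -/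
lemma joinedIn_rangeReflection_of_range_eq {T : H →L[ℝ] H} (hT : IsSelfAdjoint T)
    (hu : IsUnit T) {Ep Em : Submodule ℝ H}
    (hpc : IsClosed (Ep : Set H)) (hmc : IsClosed (Em : Set H))
    (hp : ¬ FiniteDimensional ℝ Ep) (hm : ¬ FiniteDimensional ℝ Em)
    (htop : Ep ⊔ Em = ⊤) (hort : ∀ x ∈ Ep, ∀ y ∈ Em, ⟪x, y⟫ = 0)
    (hTp : ∀ x ∈ Ep, T x ∈ Ep) (hTm : ∀ x ∈ Em, T x ∈ Em)
    (hpos : ∀ x ∈ Ep, x ≠ 0 → 0 < ⟪T x, x⟫) (hneg : ∀ x ∈ Em, x ≠ 0 → ⟪T x, x⟫ < 0)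
    {G : L →L[ℝ] H} (hG : G.adjoint ∘L G = 1) (hGr : G.range = Ep) :
    JoinedIn (stronglyIndefiniteOperators H) T (rangeReflection G) := by
  have hJp : ∀ x ∈ Ep, rangeReflection G x = x := by
    have h : ∀ y, G.adjoint (G y) = y := fun y => DFunLike.congr_fun hG y
    rw [← hGr]
    rintro _ ⟨y, rfl⟩
    simp only [ContinuousLinearMap.coe_coe, rangeReflection_apply, h]
    module
  have hJm : ∀ x ∈ Em, rangeReflection G x = -x := fun x hx => by
    have hx' : G.adjoint x = 0 := ext_inner_left ℝ fun y => by
      rw [ContinuousLinearMap.adjoint_inner_right, inner_zero_right]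
      exact hort _ (hGr ▸ ⟨y, rfl⟩) x hx
    simp [rangeReflection_apply, hx']
  have hJJ := rangeReflection_mul_self hG
  have hJu := isUnit_rangeReflection hG
  have hJs := isSelfAdjoint_rangeReflection G
  generalize rangeReflection G = J at *
  have hTp' : ∀ x ∈ Ep, 0 ≤ ⟪T x, x⟫ := fun x hx => by
    rcases eq_or_ne x 0 with rfl | h0
    · simp
    · exact (hpos x hx h0).le
  have hTm' : ∀ x ∈ Em, ⟪T x, x⟫ ≤ 0 := fun x hx => by
    rcases eq_or_ne x 0 with rfl | h0
    · simp
    · exact (hneg x hx h0).le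
  refine JoinedIn.of_segment_subset ?_
  rintro _ ⟨s, t, hs, ht, hst, rfl⟩
  rcases ht.eq_or_lt with rfl | ht
  · obtain rfl : s = 1 := by simpa using hst
    simp only [one_smul, zero_smul, add_zero]
    exact ⟨hT, hu, Ep, Em, hpc, hmc, hp, hm, htop, hort, hTp, hTm, hpos, hneg⟩
  have hMp : ∀ x ∈ Ep, (s • T + t • J) x = s • T x + t • x := fun x hx => by simp [hJp x hx]
  have hMm : ∀ x ∈ Em, (s • T + t • J) x = s • T x - t • x := fun x hx => by
    simp [hJm x hx, sub_eq_add_neg]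
  have hMp_mem : ∀ x ∈ Ep, (s • T + t • J) x ∈ Ep := fun x hx => by
    rw [hMp x hx]
    exact add_mem (Ep.smul_mem _ (hTp x hx)) (Ep.smul_mem _ hx)
  have hMm_mem : ∀ x ∈ Em, (s • T + t • J) x ∈ Em := fun x hx => by
    rw [hMm x hx]
    exact sub_mem (Em.smul_mem _ (hTm x hx)) (Em.smul_mem _ hx)
  have hMp_le : ∀ x ∈ Ep, t * ‖x‖ ^ 2 ≤ ⟪(s • T + t • J) x, x⟫ := fun x hx => by
    rw [hMp x hx, inner_add_left, real_inner_smul_left, real_inner_smul_left,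
      real_inner_self_eq_norm_sq]
    linarith [mul_nonneg hs (hTp' x hx)]
  have hMm_le : ∀ x ∈ Em, ⟪(s • T + t • J) x, x⟫ ≤ -(t * ‖x‖ ^ 2) := fun x hx => by
    rw [hMm x hx, inner_sub_left, real_inner_smul_left, real_inner_smul_left,
      real_inner_self_eq_norm_sq]
    linarith [mul_nonpos_of_nonneg_of_nonpos hs (hTm' x hx)]
  refine ⟨((IsSelfAdjoint.all s).smul hT).add ((IsSelfAdjoint.all t).smul hJs), ?_,
    Ep, Em, hpc, hmc, hp, hm, htop, hort, hMp_mem, hMm_mem, fun x hx h0 => ?_, fun x hx h0 => ?_⟩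
  · generalize s • T + t • J = M at *
    have hJM : IsUnit (J * M) := by
      refine ContinuousLinearMap.isUnit_of_forall_le_norm_inner_map _ (c := ⟨t, ht.le⟩) ht
        fun x => ?_
      obtain ⟨p, hp, m, hm, rfl⟩ := Submodule.mem_sup.1 (htop ▸ Submodule.mem_top : x ∈ Ep ⊔ Em)
      have h1 : (J * M) (p + m) = M p - M m := by
        simp [hJp _ (hMp_mem p hp), hJm _ (hMm_mem m hm), sub_eq_add_neg]
      have h2 : ⟪(J * M) (p + m), p + m⟫ = ⟪M p, p⟫ - ⟪M m, m⟫ := by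
        rw [h1, inner_sub_left, inner_add_right, inner_add_right, hort _ (hMp_mem p hp) m hm,
          real_inner_comm p (M m), hort p hp _ (hMm_mem m hm)]
        ring
      have h3 : ‖p + m‖ ^ 2 = ‖p‖ ^ 2 + ‖m‖ ^ 2 := by
        rw [norm_add_sq_real, hort p hp m hm]
        ring
      refine le_trans ?_ (le_abs_self _)
      rw [h2, h3]
      change (‖p‖ ^ 2 + ‖m‖ ^ 2) * t ≤ _
      linarith [hMp_le p hp, hMm_le m hm]
    have : J * (J * M) = M := by rw [← mul_assoc, hJJ, one_mul]
    exact this ▸ hJu.mul hJM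
  · have : 0 < t * ‖x‖ ^ 2 := by positivity
    linarith [hMp_le x hx]
  · have : 0 < t * ‖x‖ ^ 2 := by positivity
    linarith [hMm_le x hx]

end StronglyIndefinite

/-- **Lemma `lemmaconnected`.** Let `H` be a real, separable, infinite-dimensional Hilbert
space. The set of bounded operators `T : H → H` that are self-adjoint, invertible and
strongly indefinite (i.e. `H` splits as an orthogonal direct sum of two infinite-dimensional
closed `T`-invariant subspaces, on one of which the quadratic form `⟪T x, x⟫` is positive
definite and on the other negative definite) is path-connected in the operator-norm
topology. -/
theorem stronglyIndefinite_selfAdjoint_invertible_isPathConnected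
    (H : Type*) [NormedAddCommGroup H] [InnerProductSpace ℝ H] [CompleteSpace H]
    [TopologicalSpace.SeparableSpace H]
    (hinf : ¬ FiniteDimensional ℝ H) :
    IsPathConnected {T : H →L[ℝ] H |
      IsSelfAdjoint T ∧ IsUnit T ∧
      ∃ Ep Em : Submodule ℝ H,
        IsClosed (Ep : Set H) ∧ IsClosed (Em : Set H) ∧
        ¬ FiniteDimensional ℝ Ep ∧ ¬ FiniteDimensional ℝ Em ∧
        Ep ⊔ Em = ⊤ ∧
        (∀ x ∈ Ep, ∀ y ∈ Em, ⟪x, y⟫ = 0) ∧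
        (∀ x ∈ Ep, T x ∈ Ep) ∧ (∀ x ∈ Em, T x ∈ Em) ∧
        (∀ x ∈ Ep, x ≠ 0 → 0 < ⟪T x, x⟫) ∧
        (∀ x ∈ Em, x ≠ 0 → ⟪T x, x⟫ < 0)} := by
  change IsPathConnected (stronglyIndefiniteOperators H)
  have hl2 : ¬ FiniteDimensional ℝ (lp (fun _ : ℕ => ℝ) 2) := fun hfin => by
    obtain ⟨e⟩ := nonempty_linearIsometryEquiv_l2 hinf
    exact hinf e.symm.toLinearEquiv.finiteDimensional
  have key : ∀ {A B : Submodule ℝ H} {G K : lp (fun _ : ℕ => ℝ) 2 →L[ℝ] H},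
      G.adjoint ∘L G = 1 → K.adjoint ∘L K = 1 → G.range = A → K.range = B → A ⟂ B →
      JoinedIn (stronglyIndefiniteOperators H) (rangeReflection G) (rangeReflection K) :=
    fun hG hK hA hB hAB => joinedIn_rangeReflection hl2 hG hK
      (adjoint_comp_eq_zero_of_isOrtho_range (by rwa [hA, hB]))
  refine isPathConnected_iff.2 ⟨?_, ?_⟩
  · have htop : ¬ FiniteDimensional ℝ (⊤ : Submodule ℝ H) := fun hfin =>
      hinf (Submodule.topEquiv (R := ℝ) (M := H)).finiteDimensional
    obtain ⟨A, B, -, -, hAc, hBc, hA, hB, hAB⟩ :=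
      exists_isOrtho_le_of_not_finiteDimensional isClosed_univ isClosed_univ htop htop
    obtain ⟨G, hG, hGA⟩ := exists_isometry_range_eq hAc hA
    obtain ⟨K, hK, hKB⟩ := exists_isometry_range_eq hBc hB
    exact ⟨_, (key hG hK hGA hKB hAB).source_mem⟩
  · rintro T ⟨hT, hTu, E, E', hE, hE', hEi, hEi', htopE, hortE, hTE, hTE', hposE, hnegE⟩
      S ⟨hS, hSu, F, F', hF, hF', hFi, hFi', htopF, hortF, hSF, hSF', hposF, hnegF⟩
    obtain ⟨A, B, hAE, hBF, hAc, hBc, hA, hB, hAB⟩ :=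
      exists_isOrtho_le_of_not_finiteDimensional hE hF hEi hFi
    obtain ⟨GE, hGE, hGEr⟩ := exists_isometry_range_eq hE hEi
    obtain ⟨GE', hGE', hGEr'⟩ := exists_isometry_range_eq hE' hEi'
    obtain ⟨GA, hGA, hGAr⟩ := exists_isometry_range_eq hAc hA
    obtain ⟨GB, hGB, hGBr⟩ := exists_isometry_range_eq hBc hB
    obtain ⟨GF', hGF', hGFr'⟩ := exists_isometry_range_eq hF' hFi'
    obtain ⟨GF, hGF, hGFr⟩ := exists_isometry_range_eq hF hFi
    have hEE' : E ⟂ E' := Submodule.isOrtho_iff_inner_eq.2 hortE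
    have hFF' : F ⟂ F' := Submodule.isOrtho_iff_inner_eq.2 hortF
    have hTG := joinedIn_rangeReflection_of_range_eq hT hTu hE hE' hEi hEi' htopE hortE hTE hTE'
      hposE hnegE hGE hGEr
    have hSG := joinedIn_rangeReflection_of_range_eq hS hSu hF hF' hFi hFi' htopF hortF hSF hSF'
      hposF hnegF hGF hGFr
    have h1 := key hGE hGE' hGEr hGEr' hEE'
    have h2 := key hGE' hGA hGEr' hGAr (hEE'.symm.mono_right hAE)
    have h3 := key hGA hGB hGAr hGBr hAB
    have h4 := key hGB hGF' hGBr hGFr' (hFF'.mono_left hBF)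
    have h5 := key hGF' hGF hGFr' hGFr hFF'.symm
    exact ((((hTG.trans h1).trans h2).trans h3).trans h4).trans (h5.trans hSG.symm)
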